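/- arXiv:2105.08139 — 6 statements merged into one kernel-verified Lean document; each statement's English description precedes it below -/
import Mathlib

section
/- The function H : ℝ^N → ℝ is strictly concave on ℝ^N. -/
open Matrix

/-- The deterministic objective function `H = F + G/2` from the proof of Theorem 1 of
"Optimal Portfolio with Power Utility of Absolute and Relative Wealth". -/
noncomputable def Hfun {ι : Type} [Fintype ι] {k : ℕ} (A : Matrix ι ι ℝ) (g : ι → ℝ)
    (r γ : ℝ) (γ' : Fin k → ℝ) (ρ : Fin k → ι → ℝ) (p : ι → ℝ) : ℝ :=
  ((1 - γ) * (p ⬝ᵥ g + (1 - (fun _ => (1 : ℝ)) ⬝ᵥ p) * r - A.mulVec p ⬝ᵥ p / 2)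
      - ∑ j, γ' j * (ρ j ⬝ᵥ g + (1 - (fun _ => (1 : ℝ)) ⬝ᵥ ρ j) * r
          - A.mulVec (ρ j) ⬝ᵥ ρ j / 2))
    + (A.mulVec ((1 - γ) • p - ∑ j, γ' j • ρ j) ⬝ᵥ ((1 - γ) • p - ∑ j, γ' j • ρ j)) / 2


/-- The concavity defect of `Hfun` along a segment is a multiple of the quadratic form of `A`. -/
theorem Hfun_segment {ι : Type} [Fintype ι] {k : ℕ} (A : Matrix ι ι ℝ) (g : ι → ℝ)
    (r γ : ℝ) (γ' : Fin k → ℝ) (ρ : Fin k → ι → ℝ) (x y : ι → ℝ) {a b : ℝ} (hab : a + b = 1) :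
    Hfun A g r γ γ' ρ (a • x + b • y) =
      a * Hfun A g r γ γ' ρ x + b * Hfun A g r γ γ' ρ y
        + a * b * (γ * (1 - γ)) / 2 * (A.mulVec (x - y) ⬝ᵥ (x - y)) := by
  obtain rfl : b = 1 - a := by linarith
  simp only [Hfun]
  generalize (∑ j, γ' j • ρ j) = w
  simp only [mulVec_add, mulVec_sub, mulVec_smul, add_dotProduct, sub_dotProduct,
    smul_dotProduct, dotProduct_add, dotProduct_sub, dotProduct_smul, smul_eq_mul]
  ring

/-- the function `H : ℝ^N → ℝ` is strictly concave on `ℝ^N`. -/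
theorem H_strictConcave (N k : ℕ) (hN : 1 ≤ N)
    (A : Matrix (Fin N) (Fin N) ℝ) (hA : A.PosDef)
    (g : Fin N → ℝ) (r : ℝ) (γ : ℝ) (hγ : γ ∈ Set.Ioo (0 : ℝ) 1)
    (γ' : Fin k → ℝ) (ρ : Fin k → Fin N → ℝ) :
    StrictConcaveOn ℝ Set.univ (Hfun A g r γ γ' ρ) := by
  refine ⟨convex_univ, fun x _ y _ hxy a b ha hb hab => ?_⟩
  have hpos : 0 < A.mulVec (x - y) ⬝ᵥ (x - y) := by
    simpa [dotProduct_comm] using hA.dotProduct_mulVec_pos (sub_ne_zero.mpr hxy)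
  have hcoef : 0 < a * b * (γ * (1 - γ)) / 2 := by
    have := sub_pos.mpr hγ.2
    have := hγ.1
    positivity
  rw [Hfun_segment A g r γ γ' ρ x y hab, smul_eq_mul, smul_eq_mul]
  exact lt_add_of_pos_right _ (mul_pos hcoef hpos)
end

section
/- A point p ∈ ℝ^N satisfies ∇H(p) = 0 if and only if p = p* := (1/γ)·A⁻¹(g − r·𝟏) − (1/γ)·Σ_{j=1}^k γ_j ρ_j; in other words, p* is the unique critical point of H. -/
open Matrix

open scoped InnerProductSpace in
/-- The gradient of a quadratic function with symmetric quadratic part. -/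
theorem hasGradientAt_const_add_inner_add_quadratic {E : Type*} [NormedAddCommGroup E]
    [InnerProductSpace ℝ E] [CompleteSpace E] (T : E →L[ℝ] E)
    (hT : ∀ x y, ⟪T x, y⟫_ℝ = ⟪x, T y⟫_ℝ) (a c : ℝ) (b p : E) :
    HasGradientAt (fun q => a + ⟪b, q⟫_ℝ + c * ⟪T q, q⟫_ℝ) (b + (2 * c) • T p) p := by
  rw [hasGradientAt_iff_hasFDerivAt]
  have h := (((hasFDerivAt_const b p).inner ℝ (hasFDerivAt_id p)).const_add a).add
    ((T.hasFDerivAt.inner ℝ (hasFDerivAt_id p)).const_mul c)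
  refine h.congr_fderiv ?_
  ext y
  simp [hT y p, real_inner_comm (T p) y]
  ring

open scoped InnerProductSpace in
/-- `Hfun` as a constant plus a linear form plus a quadratic form. -/
theorem Hfun_eq_quadratic {N k : ℕ} {A : Matrix (Fin N) (Fin N) ℝ} (hA : A.IsSymm)
    (g : Fin N → ℝ) (r γ : ℝ) (γ' : Fin k → ℝ) (ρ : Fin k → Fin N → ℝ)
    (q : EuclideanSpace ℝ (Fin N)) :
    Hfun A g r γ γ' ρ q =
      Hfun A g r γ γ' ρ 0
        + ⟪WithLp.toLp 2 ((1 - γ) • (g - r • (fun _ => (1 : ℝ)) - A *ᵥ ∑ j, γ' j • ρ j)), q⟫_ℝ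
        + (-(γ * (1 - γ)) / 2) * ⟪Matrix.toEuclideanCLM (𝕜 := ℝ) A q, q⟫_ℝ := by
  obtain ⟨q⟩ := q
  have hsymm : ∀ x y : Fin N → ℝ, A *ᵥ x ⬝ᵥ y = A *ᵥ y ⬝ᵥ x := fun x y => by
    rw [dotProduct_comm, dotProduct_mulVec, ← mulVec_transpose, hA.eq]
  simp only [Hfun, Matrix.toEuclideanCLM_toLp, EuclideanSpace.inner_toLp_toLp, star_trivial]
  generalize ∑ j, γ' j • ρ j = s
  simp only [mulVec_sub, mulVec_smul, mulVec_zero, sub_dotProduct, dotProduct_sub,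
    smul_dotProduct, dotProduct_smul, zero_dotProduct, dotProduct_zero, smul_eq_mul, smul_zero,
    dotProduct_comm q (A *ᵥ q), dotProduct_comm q g, dotProduct_comm q (A *ᵥ s),
    dotProduct_comm q (fun _ => (1 : ℝ)), hsymm q s]
  ring

/-- `p ∈ ℝ^N` satisfies `∇H(p) = 0` if and only if
`p = p* := (1/γ)·A⁻¹(g − r·𝟏) − (1/γ)·Σ_{j=1}^k γ_j ρ_j`; i.e. `p*` is the unique
critical point of `H`. -/
theorem gradient_H_eq_zero_iff (N k : ℕ) (hN : 1 ≤ N)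
    (A : Matrix (Fin N) (Fin N) ℝ) (hA : A.PosDef)
    (g : Fin N → ℝ) (r : ℝ) (γ : ℝ) (hγ : γ ∈ Set.Ioo (0 : ℝ) 1)
    (γ' : Fin k → ℝ) (ρ : Fin k → Fin N → ℝ) :
    ∀ p : EuclideanSpace ℝ (Fin N),
      gradient (fun q : EuclideanSpace ℝ (Fin N) => Hfun A g r γ γ' ρ q) p = 0
        ↔ p = (γ⁻¹ • A⁻¹.mulVec (g - r • (fun _ => (1 : ℝ)))
              - γ⁻¹ • ∑ j, γ' j • ρ j : Fin N → ℝ) := by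
  intro p
  have hsymm : A.IsSymm := by
    simpa [Matrix.IsHermitian, Matrix.IsSymm, conjTranspose_eq_transpose_of_trivial] using hA.1
  have hdet : IsUnit A.det := hA.det_pos.ne'.isUnit
  have hγ0 : γ ≠ 0 := hγ.1.ne'
  have hγ1 : 1 - γ ≠ 0 := (sub_pos.2 hγ.2).ne'
  have hT : ∀ x y : EuclideanSpace ℝ (Fin N),
      inner ℝ (Matrix.toEuclideanCLM (𝕜 := ℝ) A x) y
        = inner ℝ x (Matrix.toEuclideanCLM (𝕜 := ℝ) A y) := by
    rintro ⟨x⟩ ⟨y⟩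
    simp only [Matrix.toEuclideanCLM_toLp, EuclideanSpace.inner_toLp_toLp, star_trivial]
    rw [dotProduct_mulVec, ← mulVec_transpose, hsymm.eq, dotProduct_comm]
  rw [funext (Hfun_eq_quadratic hsymm g r γ γ' ρ),
    (hasGradientAt_const_add_inner_add_quadratic _ hT _ _ _ p).gradient]
  obtain ⟨p⟩ := p
  generalize ∑ j, γ' j • ρ j = s
  generalize g - r • (fun _ => (1 : ℝ)) = u
  have key : (1 - γ) • (u - A *ᵥ s) + (2 * (-(γ * (1 - γ)) / 2)) • A *ᵥ p
      = (1 - γ) • (u - A *ᵥ (s + γ • p)) := by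
    rw [mulVec_add, mulVec_smul]
    module
  rw [Matrix.toEuclideanCLM_toLp, ← WithLp.toLp_smul, ← WithLp.toLp_add, WithLp.toLp_eq_zero,
    key, smul_eq_zero_iff_right hγ1, sub_eq_zero, ← smul_sub, eq_inv_smul_iff₀ hγ0,
    eq_sub_iff_add_eq']
  constructor
  · rintro rfl
    rw [mulVec_mulVec, nonsing_inv_mul _ hdet, one_mulVec]
  · intro h
    rw [h, mulVec_mulVec, mul_nonsing_inv _ hdet, one_mulVec]
end

section
/- The point p* := (1/γ)·A⁻¹(g − r·𝟏) − (1/γ)·Σ_{j=1}^k γ_j ρ_j is the unique global maximizer of H on ℝ^N: for every p ∈ ℝ^N with p ≠ p*, one has H(p) < H(p*). (This is the deterministic core of the paper's Theorem 1: the optimal portfolio is less invested in the benchmarks than the classic Merton portfolio by γ_j ρ_j / γ.) -/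
open Matrix

/-- Exact second-order expansion of `Hfun` at a stationary point `q`. -/
theorem Hfun_add_of_stationary {ι : Type} [Fintype ι] {k : ℕ} {A : Matrix ι ι ℝ}
    (hA : A.IsSymm) {g : ι → ℝ} {r γ : ℝ} {γ' : Fin k → ℝ} {ρ : Fin k → ι → ℝ} {q : ι → ℝ}
    (hq : γ • A.mulVec q = g - r • (fun _ => (1 : ℝ)) - A.mulVec (∑ j, γ' j • ρ j))
    (d : ι → ℝ) :
    Hfun A g r γ γ' ρ (q + d) =
      Hfun A g r γ γ' ρ q - (1 - γ) * γ / 2 * (A.mulVec d ⬝ᵥ d) := by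
  have hsymm (x y : ι → ℝ) : A.mulVec x ⬝ᵥ y = A.mulVec y ⬝ᵥ x := by
    rw [dotProduct_comm, dotProduct_mulVec, ← mulVec_transpose, hA.eq]
  have hqd := congrArg (· ⬝ᵥ d) hq
  unfold Hfun
  generalize ∑ j, γ' j • ρ j = s at hqd ⊢
  simp only [sub_dotProduct, smul_dotProduct, smul_eq_mul] at hqd
  simp only [mulVec_add, mulVec_sub, mulVec_smul, add_dotProduct, dotProduct_add,
    sub_dotProduct, dotProduct_sub, smul_dotProduct, dotProduct_smul, smul_eq_mul]
  rw [hsymm d q, hsymm d s, hsymm q s, dotProduct_comm d g]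
  linear_combination (γ - 1) * hqd

/-- `p* := (1/γ)·A⁻¹(g − r·𝟏) − (1/γ)·Σ_{j=1}^k γ_j ρ_j` is the unique global
maximizer of `H` on `ℝ^N`: for every `p ≠ p*`, `H(p) < H(p*)`. -/
theorem H_unique_global_max (N k : ℕ) (hN : 1 ≤ N)
    (A : Matrix (Fin N) (Fin N) ℝ) (hA : A.PosDef)
    (g : Fin N → ℝ) (r : ℝ) (γ : ℝ) (hγ : γ ∈ Set.Ioo (0 : ℝ) 1)
    (γ' : Fin k → ℝ) (ρ : Fin k → Fin N → ℝ) :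
    ∀ p : Fin N → ℝ,
      p ≠ γ⁻¹ • A⁻¹.mulVec (g - r • (fun _ => (1 : ℝ))) - γ⁻¹ • ∑ j, γ' j • ρ j →
      Hfun A g r γ γ' ρ p
        < Hfun A g r γ γ' ρ
            (γ⁻¹ • A⁻¹.mulVec (g - r • (fun _ => (1 : ℝ))) - γ⁻¹ • ∑ j, γ' j • ρ j) := by
  intro p hp
  obtain ⟨hγ0, hγ1⟩ := hγ
  set q := γ⁻¹ • A⁻¹.mulVec (g - r • (fun _ => (1 : ℝ))) - γ⁻¹ • ∑ j, γ' j • ρ j with hq_def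
  have hq : γ • A.mulVec q = g - r • (fun _ => (1 : ℝ)) - A.mulVec (∑ j, γ' j • ρ j) := by
    rw [hq_def, mulVec_sub, mulVec_smul, mulVec_smul, mulVec_mulVec,
      mul_nonsing_inv A (A.isUnit_iff_isUnit_det.mp hA.isUnit), one_mulVec, smul_sub,
      smul_inv_smul₀ hγ0.ne', smul_inv_smul₀ hγ0.ne']
  have hsymm : A.IsSymm := isHermitian_iff_isSymm.mp hA.isHermitian
  have hpos : 0 < A.mulVec (p - q) ⬝ᵥ (p - q) := by
    simpa [dotProduct_comm] using hA.dotProduct_mulVec_pos (sub_ne_zero.mpr hp)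
  have hH := Hfun_add_of_stationary hsymm hq (p - q)
  rw [add_sub_cancel] at hH
  have hcoef : 0 < (1 - γ) * γ / 2 := by
    have := sub_pos.mpr hγ1
    positivity
  linarith [mul_pos hcoef hpos]
end

section
/- Let the unique maximizer of H over the hyperplane {(q₀, q) ∈ ℝ^{N+1} : q₀ + b·q = β₀} be p* = (q₀*, q*). Then the risky-asset component q* ∈ ℝ^N satisfies γ·C·q* = v₀·b − v, i.e., q* = (1/γ)·C⁻¹(v₀ b − v), and q₀* = β₀ − b·q*. (This is the content of the paper's Theorem 2: the optimal portfolio with constrained beta in the CAPM, with the constants worked out from the Lagrange system in the proof.) -/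
open Matrix

/-- The `(N+1)×(N+1)` covariance matrix of the continuous-time CAPM (equation (eq:A-CAPM)):
`A = [[σ², σ²bᵀ], [σ²b, C + σ²bbᵀ]]`, indexed by `Unit ⊕ Fin N` (benchmark plus `N` assets). -/
noncomputable def capmMatrix (N : ℕ) (C : Matrix (Fin N) (Fin N) ℝ) (b : Fin N → ℝ)
    (σ : ℝ) : Matrix (Unit ⊕ Fin N) (Unit ⊕ Fin N) ℝ :=
  Matrix.fromBlocks (Matrix.of fun _ _ => σ ^ 2) (Matrix.of fun _ j => σ ^ 2 * b j)
    (Matrix.of fun i _ => σ ^ 2 * b i) (C + σ ^ 2 • Matrix.vecMulVec b b)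

/-- The effect on `Hfun` of a perturbation `d` of the portfolio, for a symmetric matrix. -/
theorem Hfun_add {ι : Type} [Fintype ι] {k : ℕ} {A : Matrix ι ι ℝ} (hA : A.IsSymm) (g : ι → ℝ)
    (r γ : ℝ) (γ' : Fin k → ℝ) (ρ : Fin k → ι → ℝ) (p d : ι → ℝ) :
    Hfun A g r γ γ' ρ (p + d) = Hfun A g r γ γ' ρ p
      + (1 - γ) * (d ⬝ᵥ g - ((fun _ => (1 : ℝ)) ⬝ᵥ d) * r - γ * (A *ᵥ p ⬝ᵥ d)
        - (∑ j, γ' j • A *ᵥ ρ j) ⬝ᵥ d - γ / 2 * (A *ᵥ d ⬝ᵥ d)) := by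
  have hsymm : ∀ x y : ι → ℝ, A *ᵥ x ⬝ᵥ y = A *ᵥ y ⬝ᵥ x := fun x y => by
    rw [dotProduct_comm, dotProduct_mulVec, ← mulVec_transpose, hA.eq]
  have hsum : ∑ j, γ' j • A *ᵥ ρ j = A *ᵥ ∑ j, γ' j • ρ j := by
    simp only [mulVec_sum, mulVec_smul]
  rw [hsum]
  unfold Hfun
  set s := ∑ j, γ' j • ρ j
  simp only [mulVec_add, mulVec_sub, mulVec_smul, add_dotProduct, dotProduct_add, sub_dotProduct,
    dotProduct_sub, smul_dotProduct, dotProduct_smul, smul_eq_mul]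
  rw [hsymm d p, hsymm d s]
  ring

theorem capmMatrix_isSymm {N : ℕ} {C : Matrix (Fin N) (Fin N) ℝ} (hC : C.IsSymm)
    (b : Fin N → ℝ) (σ : ℝ) : (capmMatrix N C b σ).IsSymm := by
  refine IsSymm.fromBlocks (by ext; rfl) (by ext; rfl) (hC.add (IsSymm.smul ?_ _))
  ext i j
  simp [vecMulVec_apply, mul_comm]

theorem capmMatrix_mulVec {N : ℕ} (C : Matrix (Fin N) (Fin N) ℝ) (b : Fin N → ℝ) (σ q₀ : ℝ)
    (q : Fin N → ℝ) :
    capmMatrix N C b σ *ᵥ Sum.elim (fun _ => q₀) q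
      = Sum.elim (fun _ => σ ^ 2 * (q₀ + b ⬝ᵥ q))
          (C *ᵥ q + (σ ^ 2 * (q₀ + b ⬝ᵥ q)) • b) := by
  rw [capmMatrix, fromBlocks_mulVec]
  congr 1
  · ext
    simp [mulVec, dotProduct, Finset.mul_sum, mul_add, mul_assoc]
  · ext i
    simp only [Function.comp_def, Sum.elim_inl, Sum.elim_inr, add_mulVec, smul_mulVec,
      vecMulVec_mulVec, Pi.add_apply, Pi.smul_apply, smul_eq_mul, MulOpposite.smul_eq_mul_unop,
      MulOpposite.unop_op]
    simp [mulVec, dotProduct]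
    ring

/-- In the CAPM, a perturbation leaving beta unchanged changes the covariance form only through
the idiosyncratic covariance matrix. -/
theorem capmMatrix_mulVec_dotProduct {N : ℕ} (C : Matrix (Fin N) (Fin N) ℝ) (b : Fin N → ℝ)
    (σ q₀ : ℝ) (q h : Fin N → ℝ) :
    capmMatrix N C b σ *ᵥ Sum.elim (fun _ => q₀) q ⬝ᵥ Sum.elim (fun _ => -(b ⬝ᵥ h)) h
      = C *ᵥ q ⬝ᵥ h := by
  rw [capmMatrix_mulVec, sumElim_dotProduct_sumElim, add_dotProduct, smul_dotProduct]
  simp [dotProduct]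

theorem nonpos_of_forall_mul_le_sq_mul {a c : ℝ} (h : ∀ t : ℝ, t * a ≤ t ^ 2 * c) : a ≤ 0 := by
  by_contra! ha
  have hc : 0 < c := by linarith [h 1]
  have := h (a / (2 * c))
  field_simp at this
  linarith

/-- Theorem 2 of the paper: if `p* = (q₀*, q*)` is the maximizer of `H` over the
hyperplane `{(q₀, q) : q₀ + b·q = β₀}`, then `γ·C·q* = v₀·b − v`, i.e.
`q* = (1/γ)·C⁻¹(v₀ b − v)`, and `q₀* = β₀ − b·q*`, where `(v₀, v) = Σ_j γ_j A ρ_j`. -/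
theorem capm_constrained_optimum (N k : ℕ) (hN : 1 ≤ N)
    (C : Matrix (Fin N) (Fin N) ℝ) (hC : C.PosDef) (b : Fin N → ℝ)
    (σ μ r β₀ : ℝ) (hσ : 0 < σ) (γ : ℝ) (hγ : γ ∈ Set.Ioo (0 : ℝ) 1)
    (γ' : Fin k → ℝ) (ρ : Fin k → (Unit ⊕ Fin N) → ℝ)
    (g : (Unit ⊕ Fin N) → ℝ)
    (hg : g = μ • Sum.elim (fun _ => (1 : ℝ)) b
          + r • Sum.elim (fun _ => (0 : ℝ)) (fun i => 1 - b i))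
    (v₀ : ℝ) (v : Fin N → ℝ)
    (hv₀ : v₀ = (∑ j, γ' j • (capmMatrix N C b σ).mulVec (ρ j)) (Sum.inl ()))
    (hv : v = fun i => (∑ j, γ' j • (capmMatrix N C b σ).mulVec (ρ j)) (Sum.inr i))
    (q₀s : ℝ) (qs : Fin N → ℝ)
    (hcon : q₀s + b ⬝ᵥ qs = β₀)
    (hmax : ∀ (q₀ : ℝ) (q : Fin N → ℝ), q₀ + b ⬝ᵥ q = β₀ →
        Hfun (capmMatrix N C b σ) g r γ γ' ρ (Sum.elim (fun _ => q₀) q)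
          ≤ Hfun (capmMatrix N C b σ) g r γ γ' ρ (Sum.elim (fun _ => q₀s) qs)) :
    γ • C.mulVec qs = v₀ • b - v
      ∧ qs = γ⁻¹ • C⁻¹.mulVec (v₀ • b - v)
      ∧ q₀s = β₀ - b ⬝ᵥ qs := by
  obtain ⟨hγ₀, hγ₁⟩ := hγ
  have hCs : C.IsSymm := by simpa using hC.isHermitian
  have hdrift : ∀ h : Fin N → ℝ, Sum.elim (fun _ => -(b ⬝ᵥ h)) h ⬝ᵥ g
      - ((fun _ => (1 : ℝ)) ⬝ᵥ Sum.elim (fun _ : Unit => -(b ⬝ᵥ h)) h) * r = 0 := fun h => by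
    have hone : (fun _ : Unit ⊕ Fin N => (1 : ℝ)) = Sum.elim (fun _ => 1) (fun _ => 1) := by
      ext (_ | _) <;> rfl
    have hb : (fun i => 1 - b i) = (fun _ => (1 : ℝ)) - b := rfl
    rw [hg, hone, hb, dotProduct_add, dotProduct_smul, dotProduct_smul, sumElim_dotProduct_sumElim,
      sumElim_dotProduct_sumElim, sumElim_dotProduct_sumElim, dotProduct_sub, dotProduct_comm h b,
      dotProduct_comm h (fun _ => 1)]
    simp [dotProduct]
    ring
  have hpair : ∀ h : Fin N → ℝ, (∑ j, γ' j • capmMatrix N C b σ *ᵥ ρ j)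
      ⬝ᵥ Sum.elim (fun _ => -(b ⬝ᵥ h)) h = -((v₀ • b - v) ⬝ᵥ h) := fun h => by
    have hu : (∑ j, γ' j • capmMatrix N C b σ *ᵥ ρ j) = Sum.elim (fun _ => v₀) v := by
      rw [hv₀, hv]
      ext (_ | _) <;> rfl
    rw [hu, sumElim_dotProduct_sumElim, sub_dotProduct, smul_dotProduct]
    simp [dotProduct]
    ring
  have hvar : ∀ h : Fin N → ℝ,
      (v₀ • b - v - γ • C *ᵥ qs) ⬝ᵥ h ≤ γ / 2 * (C *ᵥ h ⬝ᵥ h) := fun h => by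
    have hle := hmax (q₀s + -(b ⬝ᵥ h)) (qs + h) (by rw [dotProduct_add]; linarith)
    have hsplit : Sum.elim (fun _ : Unit => q₀s + -(b ⬝ᵥ h)) (qs + h)
        = Sum.elim (fun _ => q₀s) qs + Sum.elim (fun _ => -(b ⬝ᵥ h)) h := by
      ext (_ | _) <;> rfl
    rw [hsplit, Hfun_add (capmMatrix_isSymm hCs b σ), hdrift, hpair,
      capmMatrix_mulVec_dotProduct, capmMatrix_mulVec_dotProduct] at hle
    have := nonpos_of_mul_nonpos_right (add_le_iff_nonpos_right _ |>.mp hle) (sub_pos.mpr hγ₁)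
    rw [sub_dotProduct _ (γ • _), smul_dotProduct, smul_eq_mul]
    linarith
  have hfoc : v₀ • b - v - γ • C *ᵥ qs = 0 := by
    set x := v₀ • b - v - γ • C *ᵥ qs
    have hx : x ⬝ᵥ x ≤ 0 :=
      nonpos_of_forall_mul_le_sq_mul (c := γ / 2 * (C *ᵥ x ⬝ᵥ x)) fun t => by
        have := hvar (t • x)
        simp only [mulVec_smul, smul_dotProduct, dotProduct_smul, smul_eq_mul] at this
        linarith
    exact dotProduct_self_eq_zero.mp
      (le_antisymm hx (Finset.sum_nonneg fun i _ => mul_self_nonneg (x i)))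
  have hopt : γ • C *ᵥ qs = v₀ • b - v := (sub_eq_zero.mp hfoc).symm
  refine ⟨hopt, ?_, by linarith⟩
  rw [← hopt, mulVec_smul, mulVec_mulVec, nonsing_inv_mul _ hC.det_pos.ne'.isUnit, one_mulVec,
    smul_smul, inv_mul_cancel₀ hγ₀.ne', one_smul]
end

section
/- Suppose there is a single benchmark portfolio (k = 1) given by ρ₁ = (θ, 0, …, 0) ∈ ℝ^{N+1}, i.e., the benchmark portfolio invests fraction θ in the benchmark asset and the rest in the risk-free asset. Then the unique maximizer of H over the hyperplane {(q₀, q) ∈ ℝ^{N+1} : q₀ + b·q = β₀} is the point (β₀, 0, …, 0): the optimal portfolio with constrained beta invests β₀ in the benchmark and nothing in any other risky asset, regardless of θ, γ₁, μ, σ, C. -/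
open Matrix

/-- The CAPM variance splits into the variance due to the beta `x + b ⬝ᵥ q` and the
idiosyncratic variance `C *ᵥ q ⬝ᵥ q`. -/
theorem capmMatrix_mulVec_dotProduct_self {N : ℕ} (C : Matrix (Fin N) (Fin N) ℝ)
    (b : Fin N → ℝ) (σ x : ℝ) (q : Fin N → ℝ) :
    capmMatrix N C b σ *ᵥ Sum.elim (fun _ => x) q ⬝ᵥ Sum.elim (fun _ => x) q
      = σ ^ 2 * (x + b ⬝ᵥ q) ^ 2 + C *ᵥ q ⬝ᵥ q := by
  have mulVec_eq : capmMatrix N C b σ *ᵥ Sum.elim (fun _ => x) q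
      = Sum.elim (fun _ => σ ^ 2 * (x + b ⬝ᵥ q))
          ((σ ^ 2 * (x + b ⬝ᵥ q)) • b + C *ᵥ q) := by
    ext (i | i)
    · simp [capmMatrix, mulVec, dotProduct, Finset.mul_sum, mul_add, mul_assoc]
    · simp [capmMatrix, mulVec, dotProduct, vecMulVec_apply, add_mul, Finset.sum_add_distrib,
        mul_add, Finset.mul_sum, Finset.sum_mul]
      have h : ∑ j, σ ^ 2 * (b i * b j) * q j = ∑ j, σ ^ 2 * (b j * q j) * b i :=
        Finset.sum_congr rfl fun j _ => by ring
      linarith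
  have unit (s t : ℝ) : (fun _ : Unit => s) ⬝ᵥ (fun _ => t) = s * t := by simp [dotProduct]
  rw [mulVec_eq, sumElim_dotProduct_sumElim, add_dotProduct, smul_dotProduct, unit, smul_eq_mul]
  ring

/-- The excess drift of a portfolio in the CAPM depends only on its beta. -/
theorem capm_drift {N : ℕ} (b : Fin N → ℝ) (μ r x : ℝ) (q : Fin N → ℝ) :
    (Sum.elim (fun _ => x) q : Unit ⊕ Fin N → ℝ)
          ⬝ᵥ (μ • Sum.elim (fun _ => (1 : ℝ)) b
            + r • Sum.elim (fun _ => (0 : ℝ)) (fun i => 1 - b i))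
        + (1 - (fun _ => (1 : ℝ)) ⬝ᵥ (Sum.elim (fun _ => x) q : Unit ⊕ Fin N → ℝ)) * r
      = (μ - r) * (x + b ⬝ᵥ q) + r := by
  simp only [dotProduct, Fintype.sum_sum_type, Sum.elim_inl, Sum.elim_inr, Pi.add_apply,
    Pi.smul_apply, smul_eq_mul, Finset.univ_unique, Finset.sum_singleton, one_mul]
  have h : ∑ i, q i * (μ * b i + r * (1 - b i))
      = (μ - r) * ∑ i, b i * q i + r * ∑ i, q i := by
    rw [Finset.mul_sum, Finset.mul_sum, ← Finset.sum_add_distrib]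
    exact Finset.sum_congr rfl fun i _ => by ring
  rw [h]
  ring

/-- On portfolios of a given beta, the CAPM objective with the benchmark portfolio `(θ, 0)` is a
constant minus a multiple of the idiosyncratic variance. -/
theorem Hfun_capm {N : ℕ} (C : Matrix (Fin N) (Fin N) ℝ) (b : Fin N → ℝ)
    (σ μ r θ γ γ₁ x : ℝ) (q : Fin N → ℝ) :
    Hfun (capmMatrix N C b σ)
        (μ • Sum.elim (fun _ => (1 : ℝ)) b
          + r • Sum.elim (fun _ => (0 : ℝ)) (fun i => 1 - b i))
        r γ (fun _ : Fin 1 => γ₁) (fun _ => Sum.elim (fun _ => θ) (fun _ => (0 : ℝ)))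
        (Sum.elim (fun _ => x) q)
      = (1 - γ) * ((μ - r) * (x + b ⬝ᵥ q) + r - σ ^ 2 * (x + b ⬝ᵥ q) ^ 2 / 2)
        - γ₁ * ((μ - r) * θ + r - σ ^ 2 * θ ^ 2 / 2)
        + σ ^ 2 * ((1 - γ) * (x + b ⬝ᵥ q) - γ₁ * θ) ^ 2 / 2
        - γ * (1 - γ) / 2 * (C *ᵥ q ⬝ᵥ q) := by
  have w : (1 - γ) • (Sum.elim (fun _ => x) q : Unit ⊕ Fin N → ℝ)
        - γ₁ • Sum.elim (fun _ => θ) (fun _ => (0 : ℝ))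
      = Sum.elim (fun _ => (1 - γ) * x - γ₁ * θ) ((1 - γ) • q) := by
    ext (i | i) <;> simp
  have zero : b ⬝ᵥ (fun _ => (0 : ℝ)) = 0 := dotProduct_zero b
  have zero' : C *ᵥ (fun _ => (0 : ℝ)) ⬝ᵥ (fun _ => (0 : ℝ)) = 0 := dotProduct_zero _
  simp only [Hfun, Finset.univ_unique, Finset.sum_singleton]
  rw [w, capm_drift, capm_drift, capmMatrix_mulVec_dotProduct_self,
    capmMatrix_mulVec_dotProduct_self, capmMatrix_mulVec_dotProduct_self, zero, zero',
    mulVec_smul, smul_dotProduct, dotProduct_smul, dotProduct_smul]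
  simp only [smul_eq_mul]
  ring

/-- Example 3 of the paper: with a single benchmark portfolio
`ρ₁ = (θ, 0, …, 0)`, the unique maximizer of `H` over the hyperplane
`{(q₀, q) : q₀ + b·q = β₀}` is `(β₀, 0, …, 0)`: the optimal beta-constrained portfolio invests
`β₀` in the benchmark and nothing in the other risky assets. -/
theorem capm_one_benchmark_optimum (N : ℕ) (hN : 1 ≤ N)
    (C : Matrix (Fin N) (Fin N) ℝ) (hC : C.PosDef) (b : Fin N → ℝ)
    (σ μ r β₀ θ : ℝ) (hσ : 0 < σ) (γ : ℝ) (hγ : γ ∈ Set.Ioo (0 : ℝ) 1) (γ₁ : ℝ)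
    (g : (Unit ⊕ Fin N) → ℝ)
    (hg : g = μ • Sum.elim (fun _ => (1 : ℝ)) b
          + r • Sum.elim (fun _ => (0 : ℝ)) (fun i => 1 - b i)) :
    ∀ (q₀ : ℝ) (q : Fin N → ℝ), q₀ + b ⬝ᵥ q = β₀ →
      (Sum.elim (fun _ => q₀) q : (Unit ⊕ Fin N) → ℝ)
        ≠ (Sum.elim (fun _ => β₀) (fun _ => (0 : ℝ)) : (Unit ⊕ Fin N) → ℝ) →
      Hfun (capmMatrix N C b σ) g r γ (fun _ : Fin 1 => γ₁)
          (fun _ => Sum.elim (fun _ => θ) (fun _ => (0 : ℝ)))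
          (Sum.elim (fun _ => q₀) q)
        < Hfun (capmMatrix N C b σ) g r γ (fun _ : Fin 1 => γ₁)
            (fun _ => Sum.elim (fun _ => θ) (fun _ => (0 : ℝ)))
            (Sum.elim (fun _ => β₀) (fun _ => (0 : ℝ))) := by
  intro q₀ q hβ hne
  have hq : q ≠ 0 := by
    rintro rfl
    apply hne
    rw [dotProduct_zero, add_zero] at hβ
    rw [hβ]
    rfl
  have hpos : 0 < C *ᵥ q ⬝ᵥ q := by
    simpa [dotProduct_comm] using hC.dotProduct_mulVec_pos hq
  have zero : b ⬝ᵥ (fun _ => (0 : ℝ)) = 0 := dotProduct_zero b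
  have zero' : C *ᵥ (fun _ => (0 : ℝ)) ⬝ᵥ (fun _ => (0 : ℝ)) = 0 := dotProduct_zero _
  rw [hg, Hfun_capm, Hfun_capm, hβ, zero, zero', add_zero, mul_zero, sub_zero]
  have hγ' : 0 < γ * (1 - γ) / 2 := half_pos (mul_pos hγ.1 (sub_pos.2 hγ.2))
  exact sub_lt_self _ (mul_pos hγ' hpos)
end

section
/- Suppose there are no benchmark portfolios (k = 0), so that H(p) = (1−γ)[p·g + (1 − 𝟏·p)r] − ½γ(1−γ)(Ap)·p. Then the unique maximizer of H over the hyperplane {p ∈ ℝ^N : b·p = β₀} is p* = β₀·C⁻¹b / (b·(C⁻¹b)). In particular, the optimal beta-constrained portfolio does not depend on μ, σ, or γ. (This is the paper's Theorem 3 in the classic Merton case.) -/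
open Matrix

/-- Among the vectors `p` with prescribed `b ⬝ᵥ p`, the one with `C *ᵥ q` proportional to `b`
strictly minimizes the quadratic form of a positive definite matrix `C`. -/
theorem Matrix.PosDef.mulVec_dotProduct_lt_of_mulVec_eq_smul {n : Type*} [Fintype n]
    {C : Matrix n n ℝ} (hC : C.PosDef) {b p q : n → ℝ} {c : ℝ} (hq : C *ᵥ q = c • b)
    (hpq : b ⬝ᵥ p = b ⬝ᵥ q) (hne : p ≠ q) : C *ᵥ q ⬝ᵥ q < C *ᵥ p ⬝ᵥ p := by
  have hpos : 0 < (p - q) ⬝ᵥ C *ᵥ (p - q) := by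
    simpa using hC.dotProduct_mulVec_pos (sub_ne_zero.mpr hne)
  have hsymm : q ⬝ᵥ C *ᵥ p = C *ᵥ q ⬝ᵥ p := by
    rw [dotProduct_mulVec, ← mulVec_transpose, ← conjTranspose_eq_transpose_of_trivial,
      hC.isHermitian.eq]
  rw [mulVec_sub, dotProduct_sub, sub_dotProduct, sub_dotProduct, hsymm,
    dotProduct_comm p (C *ᵥ q), dotProduct_comm q (C *ᵥ q), dotProduct_comm p (C *ᵥ p)] at hpos
  have hcross : C *ᵥ q ⬝ᵥ p = C *ᵥ q ⬝ᵥ q := by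
    rw [hq, smul_dotProduct, smul_dotProduct, hpq]
  linarith

/-- Theorem 3 of the paper in the classic Merton case, `k = 0`: for
`H(p) = (1−γ)[p·g + (1 − 𝟏·p)r] − ½γ(1−γ)(Ap)·p` with `A = C + σ²bbᵀ` and
`g = (μ−r)b + r𝟏`, the unique maximizer of `H` over the hyperplane `{p : b·p = β₀}` is
`p* = β₀·C⁻¹b/(b·C⁻¹b)`; in particular it does not depend on `μ`, `σ`, or `γ`. -/
theorem merton_beta_constrained_optimum (N : ℕ) (hN : 1 ≤ N)
    (C : Matrix (Fin N) (Fin N) ℝ) (hC : C.PosDef) (b : Fin N → ℝ) (hb : b ≠ 0)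
    (σ μ r β₀ : ℝ) (hσ : 0 < σ) (γ : ℝ) (hγ : γ ∈ Set.Ioo (0 : ℝ) 1) :
    let A : Matrix (Fin N) (Fin N) ℝ := C + σ ^ 2 • Matrix.vecMulVec b b
    let g : Fin N → ℝ := (μ - r) • b + r • (fun _ => (1 : ℝ))
    let H : (Fin N → ℝ) → ℝ := fun p =>
      (1 - γ) * (p ⬝ᵥ g + (1 - (fun _ => (1 : ℝ)) ⬝ᵥ p) * r)
        - γ * (1 - γ) / 2 * (A.mulVec p ⬝ᵥ p)
    let pstar : Fin N → ℝ := (β₀ / (b ⬝ᵥ C⁻¹.mulVec b)) • C⁻¹.mulVec b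
    b ⬝ᵥ pstar = β₀
      ∧ ∀ p : Fin N → ℝ, b ⬝ᵥ p = β₀ → p ≠ pstar → H p < H pstar := by
  intro A g H pstar
  have hbpos : 0 < b ⬝ᵥ C⁻¹ *ᵥ b := by simpa using hC.inv.dotProduct_mulVec_pos hb
  have hstar : b ⬝ᵥ pstar = β₀ := by
    simp only [pstar, dotProduct_smul, smul_eq_mul]
    exact div_mul_cancel₀ _ hbpos.ne'
  have hCstar : C *ᵥ pstar = (β₀ / (b ⬝ᵥ C⁻¹ *ᵥ b)) • b := by
    simp only [pstar, mulVec_smul, mulVec_mulVec]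
    rw [mul_nonsing_inv C ((isUnit_iff_isUnit_det C).mp hC.isUnit), one_mulVec]
  have hH : ∀ p : Fin N → ℝ, b ⬝ᵥ p = β₀ → H p =
      (1 - γ) * ((μ - r) * β₀ + r) - γ * (1 - γ) / 2 * (C *ᵥ p ⬝ᵥ p + σ ^ 2 * β₀ ^ 2) := by
    intro p hp
    have hA : A *ᵥ p ⬝ᵥ p = C *ᵥ p ⬝ᵥ p + σ ^ 2 * β₀ ^ 2 := by
      simp only [A, add_mulVec, smul_mulVec, vecMulVec_mulVec, add_dotProduct, smul_dotProduct,
        op_smul_eq_smul, hp, smul_eq_mul]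
      ring
    have hg : p ⬝ᵥ g = (μ - r) * β₀ + r * ((fun _ => (1 : ℝ)) ⬝ᵥ p) := by
      rw [dotProduct_comm]
      simp only [g, add_dotProduct, smul_dotProduct, smul_eq_mul, hp]
    simp only [H, hA, hg]
    ring
  refine ⟨hstar, fun p hp hne => ?_⟩
  rw [hH p hp, hH pstar hstar]
  have hlt := hC.mulVec_dotProduct_lt_of_mulVec_eq_smul hCstar (hp.trans hstar.symm) hne
  have hcoef : 0 < γ * (1 - γ) / 2 := by
    have := mul_pos hγ.1 (sub_pos.mpr hγ.2)
    positivity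
  gcongr
end
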